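/- arXiv:2511.11191 — 8 statements merged into one kernel-verified Lean document; each statement's English description precedes it below -/
import Mathlib

section
/- For every real-valued paramodular pair (g, f) on a finite set T, the generalized polymatroid Q(g, f) is nonempty and bounded; in particular g({t}) ≤ x_t ≤ f({t}) holds for every x ∈ Q(g, f) and t ∈ T, and there exists at least one point x ∈ ℝ^T satisfying g(A) ≤ x(A) ≤ f(A) for all A ⊆ T. -/
/-- A set function on the subsets of a finite type is submodular. -/
def Submodular {α : Type*} [DecidableEq α] [Fintype α] (f : Finset α → ℝ) : Prop :=
  ∀ A B : Finset α, f A + f B ≥ f (A ∩ B) + f (A ∪ B)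

/-- A set function is supermodular if its negative is submodular. -/
def Supermodular {α : Type*} [DecidableEq α] [Fintype α] (g : Finset α → ℝ) : Prop :=
  Submodular (fun A => -g A)

/-- A pair `(g, f)` with `g` supermodular, `f` submodular, `g ∅ = f ∅ = 0` and
satisfying the cross-inequality is paramodular. -/
def Paramodular {α : Type*} [DecidableEq α] [Fintype α] (g f : Finset α → ℝ) : Prop :=
  Supermodular g ∧ Submodular f ∧ g ∅ = 0 ∧ f ∅ = 0 ∧
    ∀ A B : Finset α, f A - g B ≥ f (A \ B) - g (B \ A)

/-- The generalized polymatroid `Q(g, f)` of a paramodular pair. -/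
def gPolymatroid {α : Type*} [DecidableEq α] [Fintype α] (g f : Finset α → ℝ) :
    Set (α → ℝ) :=
  {x | ∀ A : Finset α, g A ≤ ∑ t ∈ A, x t ∧ ∑ t ∈ A, x t ≤ f A}

lemma exists_greedy {α : Type*} [DecidableEq α] [Fintype α] (f : Finset α → ℝ)
    (hf : Submodular f) (h0 : f ∅ = 0) (S : Finset α) :
    ∃ x : α → ℝ, (∀ A ⊆ S, ∑ t ∈ A, x t ≤ f A) ∧ ∑ t ∈ S, x t = f S := by
  induction S using Finset.induction_on with
  | empty =>
    refine ⟨0, ?_, by simp [h0]⟩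
    intro A hA
    rw [Finset.subset_empty.mp hA]
    simp [h0]
  | insert a S ha ih =>
    obtain ⟨x, hx, hS⟩ := ih
    have key : ∀ B : Finset α, a ∉ B →
        ∑ t ∈ B, Function.update x a (f (insert a S) - f S) t = ∑ t ∈ B, x t := by
      intro B hB
      refine Finset.sum_congr rfl fun t ht => ?_
      rw [Function.update_of_ne]
      rintro rfl
      exact hB ht
    refine ⟨Function.update x a (f (insert a S) - f S), ?_, ?_⟩
    · intro A hA
      by_cases haA : a ∈ A
      · have hsub : A.erase a ⊆ S := Finset.subset_insert_iff.1 hA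
        rw [← Finset.add_sum_erase A _ haA, key _ (Finset.notMem_erase a A),
          Function.update_self]
        have h1 := hx _ hsub
        have h2 := hf A S
        have e1 : A ∩ S = A.erase a := by grind
        have e2 : A ∪ S = insert a S := by grind
        rw [e1, e2] at h2
        linarith
      · rw [key A haA]
        exact hx A ((Finset.subset_insert_iff_of_notMem haA).1 hA)
    · rw [Finset.sum_insert ha, key S ha, Function.update_self, hS]
      ring

/-- For every paramodular pair `(g, f)`, the generalized polymatroid `Q(g, f)` is
nonempty and bounded; in particular `g {t} ≤ x t ≤ f {t}` for every `x ∈ Q(g, f)`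
and `t`, and there exists at least one point in `Q(g, f)`. -/
theorem gPolymatroid_nonempty_and_bounded {α : Type*} [DecidableEq α] [Fintype α]
    (g f : Finset α → ℝ) (h : Paramodular g f) :
    (gPolymatroid g f).Nonempty ∧ Bornology.IsBounded (gPolymatroid g f) ∧
      ∀ x ∈ gPolymatroid g f, ∀ t : α, g {t} ≤ x t ∧ x t ≤ f {t} := by
  have hc : ∀ x ∈ gPolymatroid g f, ∀ t : α, g {t} ≤ x t ∧ x t ≤ f {t} := by
    intro x hx t
    simpa using hx {t}
  refine ⟨?_, ?_, hc⟩
  · obtain ⟨-, hf, hg0, hf0, hcross⟩ := h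
    obtain ⟨x, hx, hT⟩ := exists_greedy f hf hf0 Finset.univ
    refine ⟨x, fun A => ⟨?_, hx A (Finset.subset_univ A)⟩⟩
    have h1 := hcross Finset.univ A
    have h2 := hx (Finset.univ \ A) (Finset.subset_univ _)
    have h3 := Finset.sum_sdiff (f := x) (Finset.subset_univ A)
    have e : A \ Finset.univ = ∅ := by simp
    rw [e, hg0] at h1
    linarith
  · refine (Metric.isBounded_Icc (fun t => g {t}) (fun t => f {t})).subset ?_
    intro x hx
    exact ⟨fun t => (hc x hx t).1, fun t => (hc x hx t).2⟩
end

section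
/- Let (g, f) be a real-valued paramodular pair on a finite set T. Then for every subset A ⊆ T, the value f(A) is the maximum of x(A) over x ∈ Q(g, f) and the value g(A) is the minimum of x(A) over x ∈ Q(g, f); both extrema are attained by points of Q(g, f). -/
theorem greedy_ext {α : Type*} [DecidableEq α] [Fintype α] (f : Finset α → ℝ)
    (hf : Submodular f) (S : Finset α) (x : α → ℝ)
    (hx : ∀ B ⊆ S, ∑ t ∈ B, x t ≤ f B) (hS : ∑ t ∈ S, x t = f S) (D : Finset α) :
    ∃ y : α → ℝ, (∀ t ∈ S, y t = x t) ∧ (∀ B ⊆ S ∪ D, ∑ t ∈ B, y t ≤ f B) ∧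
      ∑ t ∈ S ∪ D, y t = f (S ∪ D) := by
  induction D using Finset.induction_on with
  | empty => exact ⟨x, fun _ _ => rfl, by simpa using hx, by simpa using hS⟩
  | insert a D ha ih =>
    obtain ⟨y, h1, h2, h3⟩ := ih
    rw [Finset.union_insert]
    by_cases haU : a ∈ S ∪ D
    · rw [Finset.insert_eq_of_mem haU]
      exact ⟨y, h1, h2, h3⟩
    generalize hU : S ∪ D = U at *
    have hSU : S ⊆ U := hU ▸ Finset.subset_union_left
    have key : ∀ C : Finset α, a ∉ C → ∀ v,
        ∑ t ∈ C, Function.update y a v t = ∑ t ∈ C, y t := by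
      intro C hC v
      refine Finset.sum_congr rfl fun t ht => Function.update_of_ne ?_ _ _
      rintro rfl; exact hC ht
    refine ⟨Function.update y a (f (insert a U) - f U), ?_, ?_, ?_⟩
    · intro t ht
      rw [Function.update_of_ne, h1 t ht]
      rintro rfl; exact haU (hSU ht)
    · intro B hB
      by_cases haB : a ∈ B
      · have hsub : B.erase a ⊆ U := by
          intro t ht; have := hB (Finset.mem_of_mem_erase ht)
          have := Finset.ne_of_mem_erase ht; simp_all
        have e1 : B ∩ U = B.erase a := by
          ext t; have := @hB t; by_cases t = a <;> simp_all
        have e2 : B ∪ U = insert a U := by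
          ext t; have := @hB t; by_cases t = a <;> simp_all
        have := hf B U
        rw [e1, e2] at this
        rw [← Finset.add_sum_erase _ _ haB, key _ (Finset.notMem_erase a B),
          Function.update_self]
        linarith [h2 _ hsub]
      · rw [key B haB]
        exact h2 B ((Finset.subset_insert_iff_of_notMem haB).1 hB)
    · rw [Finset.sum_insert haU, key U haU, Function.update_self, h3]; ring

theorem exists_attain {α : Type*} [DecidableEq α] [Fintype α]
    (g f : Finset α → ℝ) (h : Paramodular g f) (A : Finset α) :
    ∃ x ∈ gPolymatroid g f, ∑ t ∈ A, x t = f A := by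
  obtain ⟨-, hf, hg0, hf0, hc⟩ := h
  obtain ⟨x, -, h1, h2⟩ := greedy_ext f hf ∅ 0
    (by intro B hB; rw [Finset.subset_empty.1 hB]; simp [hf0]) (by simp [hf0]) A
  rw [Finset.empty_union] at h1 h2
  obtain ⟨y, h3, h4, h5⟩ := greedy_ext f hf A x h1 h2 Finset.univ
  have hu : A ∪ Finset.univ = Finset.univ := by simp
  rw [hu] at h4 h5
  refine ⟨y, fun B => ⟨?_, h4 B (Finset.subset_univ _)⟩, ?_⟩
  · have a1 := hc Finset.univ B
    have a2 : B \ Finset.univ = ∅ := by ext; simp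
    have a3 := h4 (Finset.univ \ B) (Finset.subset_univ _)
    have a4 := Finset.sum_sdiff (f := y) (Finset.subset_univ B)
    rw [a2, hg0] at a1
    linarith
  · rw [Finset.sum_congr rfl h3, h2]

theorem gPolymatroid_border_attained {α : Type*} [DecidableEq α] [Fintype α]
    (g f : Finset α → ℝ) (h : Paramodular g f) (A : Finset α) :
    IsGreatest ((fun x : α → ℝ => ∑ t ∈ A, x t) '' gPolymatroid g f) (f A) ∧
      IsLeast ((fun x : α → ℝ => ∑ t ∈ A, x t) '' gPolymatroid g f) (g A) := by
  refine ⟨⟨exists_attain g f h A, ?_⟩, ?_, ?_⟩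
  · rintro _ ⟨x, hx, rfl⟩; exact (hx A).2
  · have h' : Paramodular (fun A => -f A) (fun A => -g A) := by
      obtain ⟨hg, hf, hg0, hf0, hc⟩ := h
      refine ⟨fun A B => ?_, hg, by simp [hf0], by simp [hg0], fun A B => ?_⟩
      · simpa using hf A B
      · have := hc B A
        linarith
    obtain ⟨x, hx, hxA⟩ := exists_attain _ _ h' A
    refine ⟨fun t => -x t, fun B => ?_, ?_⟩
    · have := hx B
      rw [Finset.sum_neg_distrib]
      constructor <;> linarith [this.1, this.2]
    · simp only [Finset.sum_neg_distrib]
      linarith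
  · rintro _ ⟨x, hx, rfl⟩; exact (hx A).1
end

section
/- Generalized polymatroids are stable under Minkowski sum: for a finite index set I and real-valued paramodular pairs (g_i, f_i), i ∈ I, on a finite set T, the Minkowski sum of the generalized polymatroids satisfies Σ_{i∈I} Q(g_i, f_i) = Q(Σ_{i∈I} g_i, Σ_{i∈I} f_i), i.e., a vector x ∈ ℝ^T can be written as x = Σ_{i∈I} x^i with x^i ∈ Q(g_i, f_i) for each i if and only if Σ_i g_i(A) ≤ x(A) ≤ Σ_i f_i(A) for every A ⊆ T. -/
open Finset in
theorem layer_aux {β : Type*} [DecidableEq β] [Fintype β] (d : β → ℝ) (n : ℕ) :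
    ∀ w : β → ℝ, (∀ t, 0 ≤ w t) → (univ.filter (fun t => 0 < w t)).card = n →
      (∀ c, 0 < c → 0 ≤ ∑ t ∈ univ.filter (fun t => c ≤ w t), d t) →
      0 ≤ ∑ t, w t * d t := by
  induction n using Nat.strong_induction_on with
  | _ n ih =>
    intro w hw hn hd
    by_cases hne : (univ.filter (fun t => 0 < w t)).Nonempty
    · obtain ⟨s, hs, hmin⟩ := exists_min_image _ w hne
      simp only [mem_filter, mem_univ, true_and] at hs hmin
      have key := ih _ ?_ (fun t => if 0 < w t then w t - w s else 0) ?_ rfl ?_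
      · have h1 : ∑ t, w t * d t = ∑ t, (if 0 < w t then w t - w s else 0) * d t
            + w s * ∑ t ∈ univ.filter (fun t => w s ≤ w t), d t := by
          rw [sum_filter, mul_sum, ← sum_add_distrib]
          refine sum_congr rfl fun t _ => ?_
          by_cases h0 : 0 < w t
          · simp only [h0, hmin t h0, if_true]; ring
          · have : w t = 0 := le_antisymm (not_lt.1 h0) (hw t)
            have h2 : ¬ w s ≤ w t := by rw [this]; exact not_le.2 hs
            rw [if_neg h0, if_neg h2, this]; ring
        rw [h1]
        exact add_nonneg key (mul_nonneg hs.le (hd _ hs))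
      · rw [← hn]
        apply card_lt_card
        rw [ssubset_iff_of_subset]
        · exact ⟨s, by simp [hs], by simp [hs]⟩
        · intro t
          simp only [mem_filter, mem_univ, true_and]
          intro h
          by_contra h0
          simp [h0] at h
      · intro t
        split_ifs with h0
        · linarith [hmin t h0]
        · exact le_rfl
      · intro c hc
        convert hd (c + w s) (by linarith) using 2
        ext t
        simp only [mem_filter, mem_univ, true_and]
        split_ifs with h0
        · constructor <;> intro h <;> linarith
        · constructor <;> intro h <;> linarith
    · have h0 : ∀ t, w t = 0 := fun t => by
        by_contra h
        exact hne ⟨t, by simpa using lt_of_le_of_ne (hw t) (Ne.symm h)⟩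
      simp [h0]

/-- prefix sets -/
def prefixSet {β : Type*} [Fintype β] (r : β → ℕ) (k : ℕ) : Finset β :=
  Finset.univ.filter (fun t => r t < k)

open Finset in
theorem prefix_step {β : Type*} [DecidableEq β] [Fintype β] (r : β → ℕ)
    (hr : Function.Injective r) (A : Finset β) (k : ℕ) :
    (A ∩ prefixSet r (k+1) = A ∩ prefixSet r k) ∨
    ∃ t, r t = k ∧ t ∉ A ∩ prefixSet r k ∧ 
      A ∩ prefixSet r (k+1) = insert t (A ∩ prefixSet r k) ∧
      prefixSet r (k+1) = (A ∩ prefixSet r (k+1)) ∪ prefixSet r k := by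
  by_cases h : ∃ t ∈ A, r t = k
  · right
    obtain ⟨t, htA, ht⟩ := h
    have hu : ∀ s, r s < k + 1 ↔ r s < k ∨ s = t := by
      intro s
      constructor
      · intro h
        rcases Nat.lt_succ_iff_lt_or_eq.1 h with h | h
        · exact Or.inl h
        · exact Or.inr (hr (h.trans ht.symm))
      · rintro (h | rfl) <;> omega
    refine ⟨t, ht, by simp [prefixSet, ht], ?_, ?_⟩
    · ext s
      simp only [prefixSet, mem_inter, mem_filter, mem_univ, true_and, mem_insert, hu]
      constructor
      · tauto
      · rintro (rfl | h) <;> tauto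
    · ext s
      simp only [prefixSet, mem_inter, mem_union, mem_filter, mem_univ, true_and, hu]
      constructor
      · rintro (h | rfl) <;> tauto
      · tauto
  · left
    push Not at h
    ext s
    simp only [prefixSet, mem_inter, mem_filter, mem_univ, true_and]
    constructor
    · rintro ⟨h1, h2⟩
      exact ⟨h1, by have := h s h1; omega⟩
    · rintro ⟨h1, h2⟩
      exact ⟨h1, by omega⟩

/-- greedy vector -/
noncomputable def greedyVec {β : Type*} [Fintype β] (r : β → ℕ) (b : Finset β → ℝ) : β → ℝ :=
  fun t => b (prefixSet r (r t + 1)) - b (prefixSet r (r t))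

open Finset in
theorem greedy_prefix {β : Type*} [DecidableEq β] [Fintype β] (r : β → ℕ)
    (hr : Function.Injective r) (b : Finset β → ℝ) (hb0 : b ∅ = 0) (k : ℕ) :
    ∑ t ∈ prefixSet r k, greedyVec r b t = b (prefixSet r k) := by
  induction k with
  | zero => simp [prefixSet, hb0]
  | succ k ih =>
    rcases prefix_step r hr univ k with h | ⟨t, ht, hn, h, -⟩
    · simp only [univ_inter] at h
      rw [h, ih]
    · simp only [univ_inter] at h hn
      conv_lhs => rw [h]
      rw [sum_insert hn, ih, greedyVec, ht]
      ring

open Finset in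
theorem greedy_le {β : Type*} [DecidableEq β] [Fintype β] (r : β → ℕ)
    (hr : Function.Injective r) (b : Finset β → ℝ) (hb0 : b ∅ = 0) (hb : Submodular b)
    (A : Finset β) (k : ℕ) :
    ∑ t ∈ A ∩ prefixSet r k, greedyVec r b t ≤ b (A ∩ prefixSet r k) := by
  induction k with
  | zero => simp [prefixSet, hb0]
  | succ k ih =>
    rcases prefix_step r hr A k with h | ⟨t, ht, hn, h, h2⟩
    · rw [h]; exact ih
    · have h3 := hb (A ∩ prefixSet r (k+1)) (prefixSet r k)
      rw [← h2] at h3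
      have h4 : (A ∩ prefixSet r (k+1)) ∩ prefixSet r k = A ∩ prefixSet r k := by
        ext s
        simp only [prefixSet, mem_inter, mem_filter, mem_univ, true_and]
        constructor
        · tauto
        · rintro ⟨h1, h2⟩
          exact ⟨⟨h1, by omega⟩, h2⟩
      rw [h4] at h3
      conv_lhs => rw [h]
      rw [sum_insert hn, greedyVec, ht]
      linarith

theorem exists_rank {β : Type*} [Fintype β] (w : β → ℝ) :
    ∃ r : β → ℕ, Function.Injective r ∧ ∀ s t, w t < w s → r s < r t := by
  classical
  let e := Fintype.equivFin β
  let v : Fin (Fintype.card β) → ℝ := fun i => - w (e.symm i)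
  refine ⟨fun t => ((Tuple.sort v).symm (e t) : ℕ), ?_, ?_⟩
  · intro s t h
    exact e.injective ((Tuple.sort v).symm.injective (Fin.ext h))
  · intro s t h
    by_contra hc
    have h1 : (Tuple.sort v).symm (e t) ≤ (Tuple.sort v).symm (e s) := by
      simpa using hc
    have := Tuple.monotone_sort v h1
    simp [v] at this
    linarith

/-- base polyhedron -/
def basePoly {β : Type*} [Fintype β] (b : Finset β → ℝ) : Set (β → ℝ) :=
  {z | (∀ A : Finset β, ∑ t ∈ A, z t ≤ b A) ∧ ∑ t, z t = b Finset.univ}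

open Finset in
theorem exists_prefix {β : Type*} [Fintype β] (w : β → ℝ) (r : β → ℕ)
    (hw : ∀ s t, w t < w s → r s < r t) (hr : Function.Injective r) (c : ℝ) :
    ∃ k, univ.filter (fun t => c ≤ w t) = prefixSet r k := by
  refine ⟨(univ.filter (fun t => c ≤ w t)).sup (fun t => r t + 1), ?_⟩
  ext t
  simp only [prefixSet, mem_filter, mem_univ, true_and]
  constructor
  · intro h
    exact Nat.lt_of_succ_le (le_sup (f := fun t => r t + 1) (by simpa using h))
  · intro h
    rw [Finset.lt_sup_iff] at h
    obtain ⟨s, hs, hst⟩ := h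
    simp only [mem_filter, mem_univ, true_and] at hs
    by_contra hc
    rcases Nat.lt_succ_iff_lt_or_eq.1 hst with h | h
    · have := hw s t (by linarith)
      omega
    · exact hc (hr h ▸ hs)

open Finset in
theorem exists_prefix_univ {β : Type*} [Fintype β] (r : β → ℕ) :
    ∃ k, univ = prefixSet r k := by
  refine ⟨univ.sup (fun t => r t + 1), ?_⟩
  ext t
  simp only [prefixSet, mem_filter, mem_univ, true_and, true_iff]
  exact Nat.lt_of_succ_le (le_sup (f := fun t => r t + 1) (mem_univ t))

open Finset in
theorem greedy_mem {β : Type*} [DecidableEq β] [Fintype β] (r : β → ℕ)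
    (hr : Function.Injective r) (b : Finset β → ℝ) (hb0 : b ∅ = 0) (hb : Submodular b) :
    greedyVec r b ∈ basePoly b := by
  obtain ⟨k, hk⟩ := exists_prefix_univ r
  constructor
  · intro A
    have := greedy_le r hr b hb0 hb A k
    rwa [← hk, inter_univ] at this
  · have := greedy_prefix r hr b hb0 k
    rwa [← hk] at this

open Finset in
theorem greedy_opt {β : Type*} [DecidableEq β] [Fintype β] {ι : Type*} [Fintype ι]
    (b : ι → Finset β → ℝ) (hb0 : ∀ i, b i ∅ = 0) (hb : ∀ i, Submodular (b i)) (w : β → ℝ)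
    (x : β → ℝ) (hx : x ∈ basePoly (fun A => ∑ i, b i A)) :
    ∃ y : ι → β → ℝ, (∀ i, y i ∈ basePoly (b i)) ∧ 
      ∑ t, w t * x t ≤ ∑ t, w t * (∑ i, y i) t := by
  obtain ⟨r, hr, hw⟩ := exists_rank w
  have hmem : ∀ i, greedyVec r (b i) ∈ basePoly (b i) := fun i => greedy_mem r hr _ (hb0 i) (hb i)
  refine ⟨fun i => greedyVec r (b i), hmem, ?_⟩
  obtain ⟨C, hC⟩ : ∃ C : ℝ, ∀ t, 0 ≤ w t + C := by
    refine ⟨∑ t, |w t|, fun t => ?_⟩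
    have := single_le_sum (f := fun t => |w t|) (fun t _ => abs_nonneg _) (mem_univ t)
    have h2 := neg_abs_le (w t)
    linarith
  set y := ∑ i, greedyVec r (b i) with hy
  have hsum : ∀ A : Finset β, ∑ t ∈ A, y t = ∑ i, ∑ t ∈ A, greedyVec r (b i) t := by
    intro A
    rw [sum_comm]
    simp [hy, Finset.sum_apply]
  have key := layer_aux (fun t => y t - x t) _ (fun t => w t + C) hC rfl ?_
  · have htot : ∑ t, y t = ∑ t, x t := by
      rw [hsum, hx.2]
      exact sum_congr rfl fun i _ => (hmem i).2
    have : ∑ t, (w t + C) * (y t - x t) = 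
        ∑ t, w t * y t - ∑ t, w t * x t + C * (∑ t, y t - ∑ t, x t) := by
      rw [mul_sub, mul_sum, mul_sum, ← sum_sub_distrib, ← sum_sub_distrib, ← sum_add_distrib]
      exact sum_congr rfl fun t _ => by ring
    rw [this, htot] at key
    linarith
  · intro c hc
    obtain ⟨k, hk⟩ := exists_prefix w r hw hr (c - C)
    have : univ.filter (fun t => c ≤ w t + C) = prefixSet r k := by
      rw [← hk]; ext t; simp
    rw [this, sum_sub_distrib, hsum, sub_nonneg]
    refine (hx.1 _).trans (le_of_eq ?_)
    exact sum_congr rfl fun i _ => (greedy_prefix r hr _ (hb0 i) k).symm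

open Finset in
theorem basePoly_compact {β : Type*} [DecidableEq β] [Fintype β] (b : Finset β → ℝ) :
    IsCompact (basePoly b) := by
  have hc : IsCompact (Set.pi Set.univ fun t : β => 
      Set.Icc (b univ - b (univ.erase t)) (b {t})) :=
    isCompact_univ_pi fun t => isCompact_Icc
  refine hc.of_isClosed_subset ?_ ?_
  · have : basePoly b = (⋂ A : Finset β, {z | ∑ t ∈ A, z t ≤ b A}) ∩ {z | ∑ t, z t = b univ} := by
      ext z; simp [basePoly]
    rw [this]
    refine IsClosed.inter (isClosed_iInter fun A => ?_) ?_
    · exact isClosed_le (by fun_prop) (by fun_prop)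
    · exact isClosed_eq (by fun_prop) (by fun_prop)
  · intro z hz t _
    have h1 := hz.1 {t}
    have h2 := hz.1 (univ.erase t)
    have h3 := hz.2
    rw [← add_sum_erase _ _ (mem_univ t)] at h3
    rw [sum_singleton] at h1
    exact ⟨by linarith, h1⟩

open Finset in
theorem basePoly_convex {β : Type*} [Fintype β] (b : Finset β → ℝ) :
    Convex ℝ (basePoly b) := by
  intro x hx y hy p q hp hq hpq
  have hs : ∀ A : Finset β, ∑ t ∈ A, (p • x + q • y) t = p * ∑ t ∈ A, x t + q * ∑ t ∈ A, y t := by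
    intro A
    simp [sum_add_distrib, mul_sum]
  constructor
  · intro A
    rw [hs]
    calc _ ≤ p * b A + q * b A := 
          add_le_add (mul_le_mul_of_nonneg_left (hx.1 A) hp) (mul_le_mul_of_nonneg_left (hy.1 A) hq)
      _ = b A := by rw [← add_mul, hpq, one_mul]
  · rw [hs, hx.2, hy.2, ← add_mul, hpq, one_mul]

open Finset in
theorem basePoly_sum {β : Type*} [DecidableEq β] [Fintype β] {ι : Type*} [Fintype ι]
    (b : ι → Finset β → ℝ) (hb0 : ∀ i, b i ∅ = 0) (hb : ∀ i, Submodular (b i))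
    (x : β → ℝ) (hx : x ∈ basePoly (fun A => ∑ i, b i A)) :
    ∃ y : ι → β → ℝ, (∀ i, y i ∈ basePoly (b i)) ∧ x = ∑ i, y i := by
  let L : (ι → β → ℝ) →ₗ[ℝ] (β → ℝ) := ∑ i, LinearMap.proj i
  have hL : ∀ y, L y = ∑ i, y i := by intro y; simp [L]
  let K : Set (ι → β → ℝ) := Set.pi Set.univ fun i => basePoly (b i)
  have hK : IsCompact K := isCompact_univ_pi fun i => basePoly_compact (b i)
  have hKc : Convex ℝ K := convex_pi fun i _ => basePoly_convex (b i)
  have hLc : Continuous L := by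
    have : (L : (ι → β → ℝ) → (β → ℝ)) = fun y => ∑ i, y i := funext hL
    rw [this]; fun_prop
  by_contra hcon
  have hxS : x ∉ L '' K := by
    rintro ⟨y, hy, rfl⟩
    exact hcon ⟨y, fun i => hy i trivial, hL y⟩
  obtain ⟨φ, u, h1, h2⟩ := geometric_hahn_banach_closed_point (hKc.linear_image L)
    (hK.image hLc).isClosed hxS
  have hφ : ∀ z : β → ℝ, φ z = ∑ t, φ (Pi.single t 1) * z t := by
    intro z
    conv_lhs => rw [pi_eq_sum_univ' z]
    rw [map_sum]
    refine sum_congr rfl fun t _ => ?_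
    rw [map_smul, smul_eq_mul, mul_comm]
  obtain ⟨y, hy, hle⟩ := greedy_opt b hb0 hb (fun t => φ (Pi.single t 1)) x hx
  rw [← hφ, ← hφ, ← hL] at hle
  have := h1 (L y) ⟨y, fun i _ => hy i, rfl⟩
  linarith

/-- the submodular extension -/
noncomputable def extFn {α : Type*} [DecidableEq α] [Fintype α] (g f : Finset α → ℝ) :
    Finset (Option α) → ℝ := fun A =>
  if none ∈ A then - g (Finset.univ.filter fun t => some t ∉ A)
  else f (Finset.univ.filter fun t => some t ∈ A)

open Finset in
theorem extFn_cross {α : Type*} [DecidableEq α] [Fintype α] {g f : Finset α → ℝ}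
    (h : Paramodular g f) (A B : Finset (Option α)) (hA : none ∉ A) (hB : none ∈ B) :
    extFn g f A + extFn g f B ≥ extFn g f (A ∩ B) + extFn g f (A ∪ B) := by
  obtain ⟨-, -, -, -, hc⟩ := h
  have := hc (univ.filter fun t => some t ∈ A) (univ.filter fun t => some t ∉ B)
  have e1 : (univ.filter fun t => some t ∈ A) \ (univ.filter fun t => some t ∉ B)
      = univ.filter fun t => some t ∈ A ∩ B := by ext; simp
  have e2 : (univ.filter fun t => some t ∉ B) \ (univ.filter fun t => some t ∈ A)
      = univ.filter fun t => some t ∉ A ∪ B := by ext; simp; tauto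
  rw [e1, e2] at this
  have n1 : none ∉ A ∩ B := by simp [hA]
  have n2 : none ∈ A ∪ B := by simp [hB]
  rw [extFn, extFn, extFn, extFn, if_neg hA, if_pos hB, if_neg n1, if_pos n2]
  linarith

open Finset in
theorem extFn_submodular {α : Type*} [DecidableEq α] [Fintype α] {g f : Finset α → ℝ}
    (h : Paramodular g f) : Submodular (extFn g f) := by
  intro A B
  by_cases hA : none ∈ A <;> by_cases hB : none ∈ B
  · have := h.1 (univ.filter fun t => some t ∉ A) (univ.filter fun t => some t ∉ B)
    have e1 : (univ.filter fun t => some t ∉ A) ∩ (univ.filter fun t => some t ∉ B)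
      = univ.filter fun t => some t ∉ A ∪ B := by ext; simp
    have e2 : (univ.filter fun t => some t ∉ A) ∪ (univ.filter fun t => some t ∉ B)
      = univ.filter fun t => some t ∉ A ∩ B := by ext; simp; tauto
    rw [e1, e2] at this
    have n1 : none ∈ A ∩ B := by simp [hA, hB]
    have n2 : none ∈ A ∪ B := by simp [hB]
    rw [extFn, extFn, extFn, extFn, if_pos hA, if_pos hB, if_pos n1, if_pos n2]
    linarith
  · have := extFn_cross h B A hB hA
    rw [inter_comm, union_comm] at this
    linarith
  · exact extFn_cross h A B hA hB
  · have := h.2.1 (univ.filter fun t => some t ∈ A) (univ.filter fun t => some t ∈ B)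
    have e1 : (univ.filter fun t => some t ∈ A) ∩ (univ.filter fun t => some t ∈ B)
      = univ.filter fun t => some t ∈ A ∩ B := by ext; simp
    have e2 : (univ.filter fun t => some t ∈ A) ∪ (univ.filter fun t => some t ∈ B)
      = univ.filter fun t => some t ∈ A ∪ B := by ext; simp
    rw [e1, e2] at this
    have n1 : none ∉ A ∩ B := by simp [hA]
    have n2 : none ∉ A ∪ B := by simp [hA, hB]
    rw [extFn, extFn, extFn, extFn, if_neg hA, if_neg hB, if_neg n1, if_neg n2]
    linarith

theorem extFn_empty {α : Type*} [DecidableEq α] [Fintype α] {g f : Finset α → ℝ}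
    (h : Paramodular g f) : extFn g f ∅ = 0 := by
  simp [extFn, h.2.2.2.1]

open Finset in
theorem sum_opt {α : Type*} [DecidableEq α] [Fintype α] (z : Option α → ℝ)
    (A : Finset (Option α)) :
    ∑ t ∈ A, z t = (if none ∈ A then z none else 0)
      + ∑ t ∈ univ.filter (fun t => some t ∈ A), z (some t) := by
  have : ∑ t ∈ A, z t = ∑ t, if t ∈ A then z t else 0 := by simp
  rw [this, Fintype.sum_option, sum_filter]

open Finset in
theorem gPoly_of_base {α : Type*} [DecidableEq α] [Fintype α] {g f : Finset α → ℝ}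
    (hg0 : g ∅ = 0) (z : Option α → ℝ) (hz : z ∈ basePoly (extFn g f)) :
    (fun t => z (some t)) ∈ gPolymatroid g f := by
  intro A
  constructor
  · have h1 := hz.1 (univ \ A.map Function.Embedding.some)
    have h2 := hz.2
    rw [← sum_sdiff (subset_univ (A.map Function.Embedding.some)), sum_map] at h2
    simp [extFn, hg0] at h1 h2
    linarith
  · have h1 := hz.1 (A.map Function.Embedding.some)
    rw [sum_map] at h1
    simpa [extFn] using h1

open Finset in
theorem base_of_gPoly {α : Type*} [DecidableEq α] [Fintype α] {g f : Finset α → ℝ}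
    (hg0 : g ∅ = 0) (x : α → ℝ) (hx : x ∈ gPolymatroid g f) :
    (fun o : Option α => o.elim (- ∑ t, x t) x) ∈ basePoly (extFn g f) := by
  constructor
  · intro A
    rw [sum_opt, extFn]
    split_ifs with h
    · have h1 := (hx (univ.filter fun t => some t ∉ A)).1
      have h2 := sum_filter_add_sum_filter_not univ (fun t => some t ∈ A) x
      simp only [Option.elim]
      linarith
    · simpa using (hx (univ.filter fun t => some t ∈ A)).2
  · rw [Fintype.sum_option]
    simp [extFn, hg0]

/-- Generalized polymatroids are stable under Minkowski sum: the Minkowski sum of the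
`Q(g i, f i)` equals the generalized polymatroid of the summed pair, i.e. `x` decomposes
as a sum of points `x^i ∈ Q(g i, f i)` iff `∑ i, g i A ≤ x(A) ≤ ∑ i, f i A` for all `A`. -/
theorem gPolymatroid_minkowski_sum {α : Type*} [DecidableEq α] [Fintype α]
    {ι : Type*} [Fintype ι] (g f : ι → Finset α → ℝ)
    (h : ∀ i : ι, Paramodular (g i) (f i)) :
    {x : α → ℝ | ∃ y : ι → α → ℝ,
        (∀ i : ι, y i ∈ gPolymatroid (g i) (f i)) ∧ x = ∑ i : ι, y i}
      = gPolymatroid (fun A => ∑ i : ι, g i A) (fun A => ∑ i : ι, f i A) := by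
  ext x
  constructor
  · rintro ⟨y, hy, rfl⟩ A
    have : ∑ t ∈ A, (∑ i, y i) t = ∑ i, ∑ t ∈ A, y i t := by
      rw [Finset.sum_comm]; simp [Finset.sum_apply]
    rw [this]
    exact ⟨Finset.sum_le_sum fun i _ => (hy i A).1, Finset.sum_le_sum fun i _ => (hy i A).2⟩
  · intro hx
    have h1 := base_of_gPoly (by simp [fun i => (h i).2.2.1]) x hx
    have h2 : extFn (fun A => ∑ i : ι, g i A) (fun A => ∑ i : ι, f i A)
        = fun A => ∑ i, extFn (g i) (f i) A := by
      funext A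
      unfold extFn
      split_ifs <;> simp
    rw [h2] at h1
    obtain ⟨y, hy, hxy⟩ := basePoly_sum _ (fun i => extFn_empty (h i))
      (fun i => extFn_submodular (h i)) _ h1
    refine ⟨fun i t => y i (some t), fun i => gPoly_of_base (h i).2.2.1 _ (hy i), ?_⟩
    funext t
    have := congrFun hxy (some t)
    simpa [Finset.sum_apply] using this
end

section
/- Every nonempty EV flexibility set is a generalized polymatroid: for any horizon T ∈ ℕ and vectors p̲, p̄, s̲, s̄ ∈ ℝ^T such that the EV flexibility set P(p̲, p̄, s̲, s̄) is nonempty, there exists a real-valued paramodular pair (g, f) on {1, …, T} such that P(p̲, p̄, s̲, s̄) = Q(g, f). -/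
/-- The EV flexibility set over horizon `T`: charging profiles respecting instantaneous
power bounds and cumulative power (state-of-charge) bounds. -/
def EVFlex (T : ℕ) (plo phi slo shi : Fin T → ℝ) : Set (Fin T → ℝ) :=
  {p | ∀ t : Fin T, (plo t ≤ p t ∧ p t ≤ phi t) ∧
        (slo t ≤ ∑ t' ∈ Finset.Iic t, p t' ∧ ∑ t' ∈ Finset.Iic t, p t' ≤ shi t)}

def EVConf {T : ℕ} (w z : Fin T → ℝ) : Prop :=
  ∀ t, ((0 ≤ w t ∧ w t ≤ z t) ∨ (z t ≤ w t ∧ w t ≤ 0)) ∧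
    ((0 ≤ ∑ s ∈ Finset.Iic t, w s ∧ ∑ s ∈ Finset.Iic t, w s ≤ ∑ s ∈ Finset.Iic t, z s) ∨
     (∑ s ∈ Finset.Iic t, z s ≤ ∑ s ∈ Finset.Iic t, w s ∧ ∑ s ∈ Finset.Iic t, w s ≤ 0))

def EVElem {T : ℕ} (w : Fin T → ℝ) : Prop :=
  ∃ c : ℝ, 0 ≤ c ∧ ((∃ i, w = Pi.single i c) ∨ (∃ i, w = -Pi.single i c) ∨
    ∃ i j, w = Pi.single i c - Pi.single j c)

theorem EVElem.neg {T : ℕ} {w : Fin T → ℝ} (h : EVElem w) : EVElem (-w) := by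
  obtain ⟨c, hc, ⟨i, rfl⟩ | ⟨i, rfl⟩ | ⟨i, j, rfl⟩⟩ := h
  · exact ⟨c, hc, Or.inr (Or.inl ⟨i, rfl⟩)⟩
  · exact ⟨c, hc, Or.inl ⟨i, by simp⟩⟩
  · exact ⟨c, hc, Or.inr (Or.inr ⟨j, i, by simp⟩)⟩

theorem EVConf.neg {T : ℕ} {w z : Fin T → ℝ} (h : EVConf w (-z)) : EVConf (-w) z := by
  intro t
  have := h t
  simp only [Pi.neg_apply, Finset.sum_neg_distrib] at this ⊢
  obtain ⟨h1, h2⟩ := this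
  constructor
  · rcases h1 with h | h
    · right; constructor <;> linarith
    · left; constructor <;> linarith
  · rcases h2 with h | h
    · right; constructor <;> linarith
    · left; constructor <;> linarith

theorem ev_step_pos {T : ℕ} (z : Fin T → ℝ) (i : Fin T) (hi : 0 < z i)
    (h0 : ∀ k, k < i → z k = 0) :
    ∃ w, EVElem w ∧ EVConf w z ∧ (∀ t, z t = 0 → w t = 0) ∧ ∃ t, z t ≠ 0 ∧ w t = z t := by
  by_cases hk : ∃ k, z k < 0
  · obtain ⟨k, hk, hmin⟩ : ∃ k, z k < 0 ∧ ∀ l, l < k → 0 ≤ z l := by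
      have hne : (Finset.univ.filter (fun k => z k < 0)).Nonempty := by
        obtain ⟨k, hk⟩ := hk
        exact ⟨k, by simpa using hk⟩
      refine ⟨Finset.min' _ hne, by simpa using Finset.min'_mem _ hne, fun l hl => ?_⟩
      by_contra hc
      have := Finset.min'_le (Finset.univ.filter (fun k => z k < 0)) l (by simpa using hc)
      exact absurd hl (not_lt.mpr this)
    have hik : i < k := by
      rcases lt_trichotomy i k with h | h | h
      · exact h
      · subst h; linarith
      · have := h0 k h; linarith
    have hc1 := min_le_left (z i) (-z k)
    have hc2 := min_le_right (z i) (-z k)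
    have hc0 : 0 < min (z i) (-z k) := lt_min hi (by linarith)
    have hc3 := min_choice (z i) (-z k)
    set c := min (z i) (-z k) with hc
    have hwi : (Pi.single i c - Pi.single k c : Fin T → ℝ) i = c := by
      simp [Pi.single_apply, hik.ne]
    have hwk : (Pi.single i c - Pi.single k c : Fin T → ℝ) k = -c := by
      simp [Pi.single_apply, hik.ne']
    have hwo : ∀ t, t ≠ i → t ≠ k → (Pi.single i c - Pi.single k c : Fin T → ℝ) t = 0 := by
      intro t h1 h2
      simp [Pi.single_apply, h1, h2]
    refine ⟨Pi.single i c - Pi.single k c, ⟨c, hc0.le, Or.inr (Or.inr ⟨i, k, rfl⟩)⟩, ?_, ?_, ?_⟩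
    · intro t
      constructor
      · by_cases h1 : t = i
        · subst h1; rw [hwi]; left; constructor <;> linarith
        by_cases h2 : t = k
        · subst h2; rw [hwk]; right; constructor <;> linarith
        rw [hwo t h1 h2]
        rcases le_total 0 (z t) with h | h
        · left; simp [h]
        · right; simp [h]
      · have hs : ∑ s ∈ Finset.Iic t, (Pi.single i c - Pi.single k c : Fin T → ℝ) s
            = (if i ≤ t then c else 0) - (if k ≤ t then c else 0) := by
          simp [Finset.sum_sub_distrib, Finset.sum_pi_single']
        rw [hs]
        by_cases h1 : i ≤ t ∧ t < k
        · left
          rw [if_pos h1.1, if_neg (not_le.mpr h1.2)]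
          have : z i ≤ ∑ s ∈ Finset.Iic t, z s := by
            apply Finset.single_le_sum (f := z) (s := Finset.Iic t)
            · intro l hl
              exact hmin l (lt_of_le_of_lt (Finset.mem_Iic.mp hl) h1.2)
            · simpa using h1.1
          constructor <;> linarith
        · have : (if i ≤ t then c else 0) - (if k ≤ t then c else 0) = 0 := by
            by_cases h2 : i ≤ t
            · have : k ≤ t := by
                by_contra h3; exact h1 ⟨h2, not_le.mp h3⟩
              simp [h2, this]
            · have : ¬ k ≤ t := fun h3 => h2 (hik.le.trans h3)
              simp [h2, this]
          rw [this]
          rcases le_total 0 (∑ s ∈ Finset.Iic t, z s) with h | h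
          · left; simp [h]
          · right; simp [h]
    · intro t ht
      apply hwo
      · rintro rfl; linarith
      · rintro rfl; linarith
    · rcases hc3 with h | h
      · exact ⟨i, hi.ne', by rw [hwi, h]⟩
      · exact ⟨k, hk.ne, by rw [hwk, h]; ring⟩
  · push Not at hk
    refine ⟨Pi.single i (z i), ⟨z i, hi.le, Or.inl ⟨i, rfl⟩⟩, ?_, ?_, ⟨i, hi.ne', by simp⟩⟩
    · intro t
      constructor
      · left
        by_cases h1 : t = i
        · subst h1; simp [hi.le]
        · simp [Pi.single_apply, h1, hk t]
      · left
        rw [Finset.sum_pi_single']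
        split_ifs with h
        · exact ⟨hi.le, Finset.single_le_sum (f := z) (fun l _ => hk l) h⟩
        · exact ⟨le_rfl, Finset.sum_nonneg (fun l _ => hk l)⟩
    · intro t ht
      have : t ≠ i := by rintro rfl; linarith
      simp [Pi.single_apply, this]

theorem ev_step {T : ℕ} (z : Fin T → ℝ) (hz : z ≠ 0) :
    ∃ w, EVElem w ∧ EVConf w z ∧ (∀ t, z t = 0 → w t = 0) ∧ ∃ t, z t ≠ 0 ∧ w t = z t := by
  obtain ⟨i, hi, hmin⟩ : ∃ i, z i ≠ 0 ∧ ∀ l, l < i → z l = 0 := by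
    have hne : (Finset.univ.filter (fun k => z k ≠ 0)).Nonempty := by
      obtain ⟨k, hk⟩ := Function.ne_iff.mp hz
      exact ⟨k, by simpa using hk⟩
    refine ⟨Finset.min' _ hne, by simpa using Finset.min'_mem _ hne, fun l hl => ?_⟩
    by_contra hc
    have := Finset.min'_le (Finset.univ.filter (fun k => z k ≠ 0)) l (by simpa using hc)
    exact absurd hl (not_lt.mpr this)
  rcases lt_or_gt_of_ne hi with h | h
  · obtain ⟨w, h1, h2, h3, t, h4, h5⟩ := ev_step_pos (-z) i (by simpa using h)
      (fun k hk => by simp [hmin k hk])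
    refine ⟨-w, h1.neg, h2.neg, fun t ht => by simp [h3 t (by simp [ht])], t, by simpa using h4, ?_⟩
    simp [h5]
  · exact ev_step_pos z i h hmin

theorem ev_select {T : ℕ} (a b : Fin T → ℝ)
    (h1 : ∀ i, b i ≤ max (a i) 0) (h2 : ∀ i, -b i ≤ max (-a i) 0)
    (h3 : ∀ i j, b i - b j ≤ max (a i - a j) 0) (n : ℕ) :
    ∀ z : Fin T → ℝ, (Finset.univ.filter (fun t => z t ≠ 0)).card ≤ n →
      ∃ d, EVConf d z ∧ ∑ t, b t * z t ≤ ∑ t, a t * d t := by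
  induction n with
  | zero =>
    intro z hz
    have : z = 0 := by
      funext t
      by_contra hc
      have h : t ∈ Finset.univ.filter (fun t => z t ≠ 0) := by simpa using hc
      rw [Finset.card_eq_zero.mp (Nat.le_zero.mp hz)] at h
      simp at h
    subst this
    exact ⟨0, fun t => by simp, by simp⟩
  | succ n ih =>
    intro z hz
    by_cases hz0 : z = 0
    · subst hz0
      exact ⟨0, fun t => by simp, by simp⟩
    obtain ⟨w, hw, hc, hs, t₀, ht₀, hwt⟩ := ev_step z hz0
    obtain ⟨d, hd, hle⟩ := ih (z - w) (by
      have : (Finset.univ.filter (fun t => (z - w) t ≠ 0)).card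
          < (Finset.univ.filter (fun t => z t ≠ 0)).card := by
        apply Finset.card_lt_card
        rw [Finset.ssubset_iff_of_subset]
        · exact ⟨t₀, by simpa using ht₀, by simp [hwt]⟩
        · intro t
          simp only [Finset.mem_filter, Finset.mem_univ, true_and, Pi.sub_apply]
          intro h h'
          apply h
          rw [h', hs t h']; simp
      omega)
    have hbz : ∑ t, b t * (z - w) t = ∑ t, b t * z t - ∑ t, b t * w t := by
      simp [mul_sub, Finset.sum_sub_distrib]
    have key : ∑ t, b t * w t ≤ max (∑ t, a t * w t) 0 := by
      obtain ⟨c, hc₀, ⟨i, rfl⟩ | ⟨i, rfl⟩ | ⟨i, j, rfl⟩⟩ := hw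
      · have := mul_le_mul_of_nonneg_right (h1 i) hc₀
        rw [max_mul_of_nonneg _ _ hc₀] at this
        simpa [Pi.single_apply] using this
      · have := mul_le_mul_of_nonneg_right (h2 i) hc₀
        rw [max_mul_of_nonneg _ _ hc₀] at this
        simpa [Pi.single_apply] using this
      · have := mul_le_mul_of_nonneg_right (h3 i j) hc₀
        rw [max_mul_of_nonneg _ _ hc₀] at this
        simpa [Pi.single_apply, mul_sub, sub_mul, Finset.sum_sub_distrib] using this
    rcases le_max_iff.mp key with h | h
    · refine ⟨d + w, ?_, ?_⟩
      · intro t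
        have e1 := hc t
        have e2 := hd t
        simp only [Pi.sub_apply, Pi.add_apply, Finset.sum_sub_distrib, Finset.sum_add_distrib] at e1 e2 ⊢
        constructor
        · rcases e1.1 with h | h <;> rcases e2.1 with h' | h' <;>
            first
            | (left; constructor <;> linarith)
            | (right; constructor <;> linarith)
        · rcases e1.2 with h | h <;> rcases e2.2 with h' | h' <;>
            first
            | (left; constructor <;> linarith)
            | (right; constructor <;> linarith)
      · simp only [Pi.add_apply, mul_add, Finset.sum_add_distrib]
        linarith
    · refine ⟨d, ?_, by linarith⟩
      intro t
      have e1 := hc t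
      have e2 := hd t
      simp only [Pi.sub_apply, Finset.sum_sub_distrib] at e1 e2 ⊢
      constructor
      · rcases e1.1 with h | h <;> rcases e2.1 with h' | h' <;>
          first
          | (left; constructor <;> linarith)
          | (right; constructor <;> linarith)
      · rcases e1.2 with h | h <;> rcases e2.2 with h' | h' <;>
          first
          | (left; constructor <;> linarith)
          | (right; constructor <;> linarith)

theorem ev_exchange {T : ℕ} {plo phi slo shi : Fin T → ℝ} {x y : Fin T → ℝ}
    (hx : x ∈ EVFlex T plo phi slo shi) (hy : y ∈ EVFlex T plo phi slo shi)
    (a b : Fin T → ℝ)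
    (h1 : ∀ i, b i ≤ max (a i) 0) (h2 : ∀ i, -b i ≤ max (-a i) 0)
    (h3 : ∀ i j, b i - b j ≤ max (a i - a j) 0) :
    ∃ d, x + d ∈ EVFlex T plo phi slo shi ∧ y - d ∈ EVFlex T plo phi slo shi ∧
      ∑ t, b t * (y t - x t) ≤ ∑ t, a t * d t := by
  obtain ⟨d, hd, hle⟩ := ev_select a b h1 h2 h3 _ (y - x) le_rfl
  refine ⟨d, ?_, ?_, hle⟩
  · intro t
    have e := hd t
    obtain ⟨⟨x1, x2⟩, x3, x4⟩ := hx t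
    obtain ⟨⟨y1, y2⟩, y3, y4⟩ := hy t
    simp only [Pi.sub_apply, Pi.add_apply, Finset.sum_sub_distrib, Finset.sum_add_distrib] at e ⊢
    obtain ⟨e1, e2⟩ := e
    rcases e1 with h | h <;> rcases e2 with h' | h' <;>
      refine ⟨⟨?_, ?_⟩, ?_, ?_⟩ <;> linarith
  · intro t
    have e := hd t
    obtain ⟨⟨x1, x2⟩, x3, x4⟩ := hx t
    obtain ⟨⟨y1, y2⟩, y3, y4⟩ := hy t
    simp only [Pi.sub_apply, Finset.sum_sub_distrib] at e ⊢
    obtain ⟨e1, e2⟩ := e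
    rcases e1 with h | h <;> rcases e2 with h' | h' <;>
      refine ⟨⟨?_, ?_⟩, ?_, ?_⟩ <;> linarith

theorem ev_sum_ind {T : ℕ} (A : Finset (Fin T)) (x : Fin T → ℝ) :
    ∑ t ∈ A, x t = ∑ t, (if t ∈ A then 1 else 0) * x t := by
  simp

/-- Uncrossing for sub/supermodularity. -/
theorem ev_sub {T : ℕ} {plo phi slo shi : Fin T → ℝ} {x y : Fin T → ℝ}
    (hx : x ∈ EVFlex T plo phi slo shi) (hy : y ∈ EVFlex T plo phi slo shi)
    (A B : Finset (Fin T)) :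
    ∃ u ∈ EVFlex T plo phi slo shi, ∃ v ∈ EVFlex T plo phi slo shi, u + v = x + y ∧
      ∑ t ∈ A ∩ B, x t + ∑ t ∈ A ∪ B, y t ≤ ∑ t ∈ A, u t + ∑ t ∈ B, v t := by
  obtain ⟨d, hu, hv, h⟩ := ev_exchange hx hy
    (fun t => (if t ∈ A then 1 else 0) - (if t ∈ B then 1 else 0))
    (fun t => if t ∈ A \ B then 1 else 0)
    (by intro i; by_cases hA : i ∈ A <;> by_cases hB : i ∈ B <;> simp [hA, hB])
    (by intro i; by_cases hA : i ∈ A <;> by_cases hB : i ∈ B <;> simp [hA, hB])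
    (by
      intro i j
      by_cases hA : i ∈ A <;> by_cases hB : i ∈ B <;> by_cases hA' : j ∈ A <;>
        by_cases hB' : j ∈ B <;> simp [hA, hB, hA', hB'] <;> norm_num)
  refine ⟨_, hu, _, hv, by simp, ?_⟩
  rw [← sub_nonneg] at h ⊢
  refine h.trans_eq ?_
  rw [ev_sum_ind (A ∩ B), ev_sum_ind (A ∪ B), ev_sum_ind A, ev_sum_ind B]
  simp only [Pi.add_apply, Pi.sub_apply, ← Finset.sum_add_distrib, ← Finset.sum_sub_distrib]
  apply Finset.sum_congr rfl
  intro t _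
  by_cases hA : t ∈ A <;> by_cases hB : t ∈ B <;> simp [hA, hB]
  all_goals ring

/-- Uncrossing for the cross-inequality. -/
theorem ev_cross {T : ℕ} {plo phi slo shi : Fin T → ℝ} {x y : Fin T → ℝ}
    (hx : x ∈ EVFlex T plo phi slo shi) (hy : y ∈ EVFlex T plo phi slo shi)
    (A B : Finset (Fin T)) :
    ∃ u ∈ EVFlex T plo phi slo shi, ∃ v ∈ EVFlex T plo phi slo shi,
      ∑ t ∈ A \ B, x t - ∑ t ∈ B \ A, y t ≤ ∑ t ∈ A, u t - ∑ t ∈ B, v t := by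
  obtain ⟨d, hu, hv, h⟩ := ev_exchange hx hy
    (fun t => (if t ∈ A then 1 else 0) + (if t ∈ B then 1 else 0))
    (fun t => if t ∈ A ∩ B then 1 else 0)
    (by intro i; by_cases hA : i ∈ A <;> by_cases hB : i ∈ B <;> simp [hA, hB])
    (by intro i; by_cases hA : i ∈ A <;> by_cases hB : i ∈ B <;> simp [hA, hB])
    (by
      intro i j
      by_cases hA : i ∈ A <;> by_cases hB : i ∈ B <;> by_cases hA' : j ∈ A <;>
        by_cases hB' : j ∈ B <;> simp [hA, hB, hA', hB'] <;> norm_num)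
  refine ⟨_, hu, _, hv, ?_⟩
  rw [← sub_nonneg] at h ⊢
  refine h.trans_eq ?_
  rw [ev_sum_ind (A \ B), ev_sum_ind (B \ A), ev_sum_ind A, ev_sum_ind B]
  simp only [Pi.add_apply, Pi.sub_apply, ← Finset.sum_add_distrib, ← Finset.sum_sub_distrib]
  apply Finset.sum_congr rfl
  intro t _
  by_cases hA : t ∈ A <;> by_cases hB : t ∈ B <;> simp [hA, hB]
  all_goals ring

/-- Every nonempty EV flexibility set is a generalized polymatroid. -/
theorem evFlex_isGPolymatroid (T : ℕ) (plo phi slo shi : Fin T → ℝ)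
    (hne : (EVFlex T plo phi slo shi).Nonempty) :
    ∃ g f : Finset (Fin T) → ℝ, Paramodular g f ∧
      EVFlex T plo phi slo shi = gPolymatroid g f := by
  have hf : ∀ A : Finset (Fin T), ∃ m : ℝ,
      (∀ x ∈ EVFlex T plo phi slo shi, ∑ t ∈ A, x t ≤ m) ∧
      ∀ c, (∀ x ∈ EVFlex T plo phi slo shi, ∑ t ∈ A, x t ≤ c) → m ≤ c := by
    intro A
    obtain ⟨m, hm⟩ := Real.exists_isLUB
      (s := (fun x : Fin T → ℝ => ∑ t ∈ A, x t) '' EVFlex T plo phi slo shi) (hne.image _)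
      ⟨∑ t ∈ A, phi t, by
        rintro _ ⟨x, hx, rfl⟩
        exact Finset.sum_le_sum fun t _ => (hx t).1.2⟩
    exact ⟨m, fun x hx => hm.1 ⟨x, hx, rfl⟩, fun c hc => hm.2 (by
      rintro _ ⟨x, hx, rfl⟩; exact hc x hx)⟩
  have hg : ∀ A : Finset (Fin T), ∃ m : ℝ,
      (∀ x ∈ EVFlex T plo phi slo shi, m ≤ ∑ t ∈ A, x t) ∧
      ∀ c, (∀ x ∈ EVFlex T plo phi slo shi, c ≤ ∑ t ∈ A, x t) → c ≤ m := by
    intro A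
    obtain ⟨m, hm⟩ := Real.exists_isGLB
      (s := (fun x : Fin T → ℝ => ∑ t ∈ A, x t) '' EVFlex T plo phi slo shi) (hne.image _)
      ⟨∑ t ∈ A, plo t, by
        rintro _ ⟨x, hx, rfl⟩
        exact Finset.sum_le_sum fun t _ => (hx t).1.1⟩
    exact ⟨m, fun x hx => hm.1 ⟨x, hx, rfl⟩, fun c hc => hm.2 (by
      rintro _ ⟨x, hx, rfl⟩; exact hc x hx)⟩
  choose f hf1 hf2 using hf
  choose g hg1 hg2 using hg
  refine ⟨g, f, ⟨?_, ?_, ?_, ?_, ?_⟩, ?_⟩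
  · intro A B
    change -g A + -g B ≥ -g (A ∩ B) + -g (A ∪ B)
    have : g A + g B - g (A ∪ B) ≤ g (A ∩ B) := by
      apply hg2
      intro y hy
      have : g A + g B - ∑ t ∈ A ∩ B, y t ≤ g (A ∪ B) := by
        apply hg2
        intro x hx
        obtain ⟨u, hu, v, hv, huv, h⟩ := ev_sub hx hy A B
        have e1 := hg1 A v hv
        have e2 := hg1 B u hu
        have k1 : ∑ t ∈ A, u t + ∑ t ∈ A, v t = ∑ t ∈ A, x t + ∑ t ∈ A, y t := by
          rw [← Finset.sum_add_distrib, ← Finset.sum_add_distrib]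
          exact Finset.sum_congr rfl fun t _ => congrFun huv t
        have k2 : ∑ t ∈ B, u t + ∑ t ∈ B, v t = ∑ t ∈ B, x t + ∑ t ∈ B, y t := by
          rw [← Finset.sum_add_distrib, ← Finset.sum_add_distrib]
          exact Finset.sum_congr rfl fun t _ => congrFun huv t
        have k3 := Finset.sum_union_inter (s₁ := A) (s₂ := B) (f := x)
        have k4 := Finset.sum_union_inter (s₁ := A) (s₂ := B) (f := y)
        linarith
      linarith
    linarith
  · intro A B
    have : f (A ∩ B) ≤ f A + f B - f (A ∪ B) := by
      apply hf2
      intro x hx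
      have : f (A ∪ B) ≤ f A + f B - ∑ t ∈ A ∩ B, x t := by
        apply hf2
        intro y hy
        obtain ⟨u, hu, v, hv, -, h⟩ := ev_sub hx hy A B
        have e1 := hf1 A u hu
        have e2 := hf1 B v hv
        linarith
      linarith
    linarith
  · obtain ⟨x, hx⟩ := hne
    exact le_antisymm (by simpa using hg1 ∅ x hx) (hg2 ∅ 0 (by simp))
  · obtain ⟨x, hx⟩ := hne
    exact le_antisymm (hf2 ∅ 0 (by simp)) (by simpa using hf1 ∅ x hx)
  · intro A B
    have : f (A \ B) ≤ f A - g B + g (B \ A) := by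
      apply hf2
      intro x hx
      have : ∑ t ∈ A \ B, x t - f A + g B ≤ g (B \ A) := by
        apply hg2
        intro y hy
        obtain ⟨u, hu, v, hv, h⟩ := ev_cross hx hy A B
        have e1 := hf1 A u hu
        have e2 := hg1 B v hv
        linarith
      linarith
    linarith
  · ext x
    constructor
    · intro hx A
      exact ⟨hg1 A x hx, hf1 A x hx⟩
    · intro hx t
      have e1 := hx {t}
      have e2 := hx (Finset.Iic t)
      simp only [Finset.sum_singleton] at e1
      refine ⟨⟨le_trans (hg2 _ _ ?_) e1.1, le_trans e1.2 (hf2 _ _ ?_)⟩,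
        le_trans (hg2 _ _ ?_) e2.1, le_trans e2.2 (hf2 _ _ ?_)⟩
      · intro y hy; simpa using (hy t).1.1
      · intro y hy; simpa using (hy t).1.2
      · intro y hy; exact (hy t).2.1
      · intro y hy; exact (hy t).2.2
end

section
/- Let T be a finite set and F a laminar family of subsets of T that contains every singleton {t}, t ∈ T. Let g̃, f̃ : F → ℝ be arbitrary bound functions and suppose the polyhedron P = { x ∈ ℝ^T | g̃(A) ≤ x(A) ≤ f̃(A) for every A ∈ F } is nonempty. Then P is a generalized polymatroid: there exists a real-valued paramodular pair (g, f) on T with P = Q(g, f). -/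
/-- A family of subsets is laminar if any two members are nested or disjoint. -/
def Laminar {α : Type*} [DecidableEq α] [Fintype α] (F : Set (Finset α)) : Prop :=
  ∀ A ∈ F, ∀ B ∈ F, A ⊆ B ∨ B ⊆ A ∨ A ∩ B = ∅

/-- `S` separates the set function `f`. -/
def SepBy {α : Type*} [DecidableEq α] (f : Finset α → ℝ) (S : Finset α) : Prop :=
  ∀ A, f A = f (A ∩ S) + f (A \ S)

theorem plank_step {α : Type*} [DecidableEq α] [Fintype α]
    (g f : Finset α → ℝ) (h : Paramodular g f) (M : Finset α)
    (sf : SepBy f M) (sg : SepBy g M) (a b : ℝ) (x0 : α → ℝ) (hx0 : x0 ∈ gPolymatroid g f)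
    (ha : a ≤ ∑ t ∈ M, x0 t) (hb : ∑ t ∈ M, x0 t ≤ b) :
    ∃ g1 f1 : Finset α → ℝ, Paramodular g1 f1 ∧
      (∀ x, x ∈ gPolymatroid g1 f1 ↔
        x ∈ gPolymatroid g f ∧ a ≤ ∑ t ∈ M, x t ∧ ∑ t ∈ M, x t ≤ b) ∧
      ∀ S, (M ⊆ S ∨ M ∩ S = ∅) → SepBy f S → SepBy g S → SepBy f1 S ∧ SepBy g1 S := by
  obtain ⟨hg, hf, g0, f0, hc⟩ := h
  have hg' : ∀ A B, g A + g B ≤ g (A ∩ B) + g (A ∪ B) := by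
    intro A B
    have := hg A B
    simp only at this
    linarith
  have hM := hx0 M
  have e0 : min (f ∅) (b - g M) = 0 := by rw [f0]; apply min_eq_left; linarith
  have e0' : max (g ∅) (a - f M) = 0 := by rw [g0]; apply max_eq_left; linarith
  refine ⟨fun A => max (g (A ∩ M)) (a - f (M \ A)) + g (A \ M),
    fun A => min (f (A ∩ M)) (b - g (M \ A)) + f (A \ M), ⟨?_, ?_, ?_, ?_, ?_⟩, ?_, ?_⟩
  · intro A B
    simp only
    have h1 := hg' (A ∩ M) (B ∩ M)
    have h2 := hf (M \ A) (M \ B)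
    have h3 := hg' (A \ M) (B \ M)
    have h4 := hc (M \ B) (A ∩ M)
    have h5 := hc (M \ A) (B ∩ M)
    rw [show A ∩ M ∩ (B ∩ M) = A ∩ B ∩ M by grind, show A ∩ M ∪ B ∩ M = (A ∪ B) ∩ M by grind] at h1
    rw [show (M \ A) ∩ (M \ B) = M \ (A ∪ B) by grind,
      show (M \ A) ∪ (M \ B) = M \ (A ∩ B) by grind] at h2
    rw [show (A \ M) ∩ (B \ M) = (A ∩ B) \ M by grind,
      show (A \ M) ∪ (B \ M) = (A ∪ B) \ M by grind] at h3
    rw [show (M \ B) \ (A ∩ M) = M \ (A ∪ B) by grind,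
      show (A ∩ M) \ (M \ B) = A ∩ B ∩ M by grind] at h4
    rw [show (M \ A) \ (B ∩ M) = M \ (A ∪ B) by grind,
      show (B ∩ M) \ (M \ A) = A ∩ B ∩ M by grind] at h5
    have m1 := le_max_left (g (A ∩ B ∩ M)) (a - f (M \ (A ∩ B)))
    have m2 := le_max_right (g (A ∩ B ∩ M)) (a - f (M \ (A ∩ B)))
    have m3 := le_max_left (g ((A ∪ B) ∩ M)) (a - f (M \ (A ∪ B)))
    have m4 := le_max_right (g ((A ∪ B) ∩ M)) (a - f (M \ (A ∪ B)))
    rcases max_choice (g (A ∩ M)) (a - f (M \ A)) with e | e <;>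
    rcases max_choice (g (B ∩ M)) (a - f (M \ B)) with e' | e' <;>
    rw [e, e'] <;> linarith
  · intro A B
    simp only
    have h1 := hf (A ∩ M) (B ∩ M)
    have h2 := hg' (M \ A) (M \ B)
    have h3 := hf (A \ M) (B \ M)
    have h4 := hc (A ∩ M) (M \ B)
    have h5 := hc (B ∩ M) (M \ A)
    rw [show A ∩ M ∩ (B ∩ M) = A ∩ B ∩ M by grind, show A ∩ M ∪ B ∩ M = (A ∪ B) ∩ M by grind] at h1
    rw [show (M \ A) ∩ (M \ B) = M \ (A ∪ B) by grind,
      show (M \ A) ∪ (M \ B) = M \ (A ∩ B) by grind] at h2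
    rw [show (A \ M) ∩ (B \ M) = (A ∩ B) \ M by grind,
      show (A \ M) ∪ (B \ M) = (A ∪ B) \ M by grind] at h3
    rw [show (M \ B) \ (A ∩ M) = M \ (A ∪ B) by grind,
      show (A ∩ M) \ (M \ B) = A ∩ B ∩ M by grind] at h4
    rw [show (M \ A) \ (B ∩ M) = M \ (A ∪ B) by grind,
      show (B ∩ M) \ (M \ A) = A ∩ B ∩ M by grind] at h5
    have m1 := min_le_left (f (A ∩ B ∩ M)) (b - g (M \ (A ∩ B)))
    have m2 := min_le_right (f (A ∩ B ∩ M)) (b - g (M \ (A ∩ B)))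
    have m3 := min_le_left (f ((A ∪ B) ∩ M)) (b - g (M \ (A ∪ B)))
    have m4 := min_le_right (f ((A ∪ B) ∩ M)) (b - g (M \ (A ∪ B)))
    rcases min_choice (f (A ∩ M)) (b - g (M \ A)) with e | e <;>
    rcases min_choice (f (B ∩ M)) (b - g (M \ B)) with e' | e' <;>
    rw [e, e'] <;> linarith
  · simp [e0', g0]
    linarith
  · simp [e0, f0]
    linarith
  · intro A B
    simp only
    have h1 := hc (A ∩ M) (B ∩ M)
    have h2 := hf (A ∩ M) (M \ B)
    have h3 := hc (A \ M) (B \ M)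
    have h4 := hg' (M \ A) (B ∩ M)
    have h5 := hc (M \ B) (M \ A)
    rw [show (A ∩ M) \ (B ∩ M) = (A \ B) ∩ M by grind,
      show (B ∩ M) \ (A ∩ M) = (B \ A) ∩ M by grind] at h1
    rw [show (A ∩ M) ∩ (M \ B) = (A \ B) ∩ M by grind,
      show (A ∩ M) ∪ (M \ B) = M \ (B \ A) by grind] at h2
    rw [show (A \ M) \ (B \ M) = (A \ B) \ M by grind,
      show (B \ M) \ (A \ M) = (B \ A) \ M by grind] at h3
    rw [show (M \ A) ∩ (B ∩ M) = (B \ A) ∩ M by grind,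
      show (M \ A) ∪ (B ∩ M) = M \ (A \ B) by grind] at h4
    rw [show (M \ B) \ (M \ A) = (A \ B) ∩ M by grind,
      show (M \ A) \ (M \ B) = (B \ A) ∩ M by grind] at h5
    have m1 := min_le_left (f ((A \ B) ∩ M)) (b - g (M \ (A \ B)))
    have m2 := min_le_right (f ((A \ B) ∩ M)) (b - g (M \ (A \ B)))
    have m3 := le_max_left (g ((B \ A) ∩ M)) (a - f (M \ (B \ A)))
    have m4 := le_max_right (g ((B \ A) ∩ M)) (a - f (M \ (B \ A)))
    rcases min_choice (f (A ∩ M)) (b - g (M \ A)) with e | e <;>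
    rcases max_choice (g (B ∩ M)) (a - f (M \ B)) with e' | e' <;>
    rw [e, e'] <;> linarith
  · intro x
    constructor
    · intro hx
      refine ⟨fun A => ?_, ?_, ?_⟩
      · obtain ⟨p, q⟩ := hx A
        simp only at p q
        have m1 := min_le_left (f (A ∩ M)) (b - g (M \ A))
        have m3 := le_max_left (g (A ∩ M)) (a - f (M \ A))
        have := sf A
        have := sg A
        constructor <;> linarith
      · obtain ⟨p, q⟩ := hx M
        simp only [Finset.inter_self, Finset.sdiff_self, g0, f0] at p q
        have := le_max_right (g M) (a - 0)
        linarith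
      · obtain ⟨p, q⟩ := hx M
        simp only [Finset.inter_self, Finset.sdiff_self, g0, f0] at p q
        have := min_le_right (f M) (b - 0)
        linarith
    · rintro ⟨hx, p, q⟩ A
      have k1 := hx (A ∩ M)
      have k2 := hx (M \ A)
      have k3 := hx (A \ M)
      have s1 := Finset.sum_inter_add_sum_sdiff A M x
      have s2 := Finset.sum_inter_add_sum_sdiff M A x
      rw [Finset.inter_comm] at s2
      have n1 : ∑ t ∈ A ∩ M, x t ≤ min (f (A ∩ M)) (b - g (M \ A)) :=
        le_min (by linarith) (by linarith)
      have n2 : max (g (A ∩ M)) (a - f (M \ A)) ≤ ∑ t ∈ A ∩ M, x t :=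
        max_le (by linarith) (by linarith)
      constructor <;> simp only <;> linarith
  · intro S hS tf tg
    constructor
    · intro A
      simp only
      have t := tf (A \ M)
      rcases hS with hS | hS
      · rw [show A ∩ S ∩ M = A ∩ M by grind, show M \ (A ∩ S) = M \ A by grind,
          show (A \ S) ∩ M = ∅ by grind, show M \ (A \ S) = M by grind, e0,
          show (A ∩ S) \ M = (A \ M) ∩ S by grind, show (A \ S) \ M = (A \ M) \ S by grind]
        linarith
      · have hd : ∀ t, t ∈ M → t ∉ S := fun t h1 h2 => by
          have : t ∈ M ∩ S := Finset.mem_inter.2 ⟨h1, h2⟩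
          simp [hS] at this
        rw [show A ∩ S ∩ M = ∅ by grind, show M \ (A ∩ S) = M by grind,
          show (A \ S) ∩ M = A ∩ M by grind, show M \ (A \ S) = M \ A by grind, e0,
          show (A ∩ S) \ M = (A \ M) ∩ S by grind, show (A \ S) \ M = (A \ M) \ S by grind]
        linarith
    · intro A
      simp only
      have t := tg (A \ M)
      rcases hS with hS | hS
      · rw [show A ∩ S ∩ M = A ∩ M by grind, show M \ (A ∩ S) = M \ A by grind,
          show (A \ S) ∩ M = ∅ by grind, show M \ (A \ S) = M by grind, e0',
          show (A ∩ S) \ M = (A \ M) ∩ S by grind, show (A \ S) \ M = (A \ M) \ S by grind]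
        linarith
      · have hd : ∀ t, t ∈ M → t ∉ S := fun t h1 h2 => by
          have : t ∈ M ∩ S := Finset.mem_inter.2 ⟨h1, h2⟩
          simp [hS] at this
        rw [show A ∩ S ∩ M = ∅ by grind, show M \ (A ∩ S) = M by grind,
          show (A \ S) ∩ M = A ∩ M by grind, show M \ (A \ S) = M \ A by grind, e0',
          show (A ∩ S) \ M = (A \ M) ∩ S by grind, show (A \ S) \ M = (A \ M) \ S by grind]
        linarith

theorem sum_sep {α : Type*} [DecidableEq α] (u : α → ℝ) (S : Finset α) :
    SepBy (fun A => ∑ t ∈ A, u t) S :=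
  fun A => (Finset.sum_inter_add_sum_sdiff A S u).symm

theorem laminar_aux {α : Type*} [DecidableEq α] [Fintype α]
    (g' f' : Finset α → ℝ) (x0 : α → ℝ) 
    (hs0 : ∀ t, g' {t} ≤ x0 t ∧ x0 t ≤ f' {t}) (G : Finset (Finset α)) :
    (∀ A ∈ G, ∀ B ∈ G, A ⊆ B ∨ B ⊆ A ∨ A ∩ B = ∅) →
    (∀ A ∈ G, g' A ≤ ∑ t ∈ A, x0 t ∧ ∑ t ∈ A, x0 t ≤ f' A) →
    ∃ g f : Finset α → ℝ, Paramodular g f ∧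
      (∀ x, x ∈ gPolymatroid g f ↔ (∀ t, g' {t} ≤ x t ∧ x t ≤ f' {t}) ∧
        ∀ A ∈ G, g' A ≤ ∑ t ∈ A, x t ∧ ∑ t ∈ A, x t ≤ f' A) ∧
      ∀ S, (∀ A ∈ G, A ⊆ S ∨ A ∩ S = ∅) → SepBy f S ∧ SepBy g S := by
  induction G using Finset.induction_on_max_value (fun A : Finset α => A.card) with
  | empty =>
    intro _ _
    refine ⟨fun A => ∑ t ∈ A, g' {t}, fun A => ∑ t ∈ A, f' {t}, ⟨?_, ?_, ?_, ?_, ?_⟩, ?_,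
      fun S _ => ⟨sum_sep _ S, sum_sep _ S⟩⟩
    · intro A B
      have := Finset.sum_union_inter (s₁ := A) (s₂ := B) (f := fun t => g' {t})
      simp only
      linarith
    · intro A B
      have := Finset.sum_union_inter (s₁ := A) (s₂ := B) (f := fun t => f' {t})
      simp only
      linarith
    · simp
    · simp
    · intro A B
      simp only
      have h1 := Finset.sum_inter_add_sum_sdiff A B (fun t => f' {t})
      have h2 := Finset.sum_inter_add_sum_sdiff B A (fun t => g' {t})
      have h3 : ∑ t ∈ A ∩ B, g' {t} ≤ ∑ t ∈ A ∩ B, f' {t} :=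
        Finset.sum_le_sum fun t _ => (hs0 t).1.trans (hs0 t).2
      rw [Finset.inter_comm] at h2
      linarith
    · intro x
      constructor
      · intro hx
        exact ⟨fun t => by simpa using hx {t}, by simp⟩
      · rintro ⟨hx, -⟩ A
        exact ⟨Finset.sum_le_sum fun t _ => (hx t).1, Finset.sum_le_sum fun t _ => (hx t).2⟩
  | insert M s hM hmax ih =>
    intro hl hx
    obtain ⟨g, f, hp, hQ, hS⟩ := ih
      (fun A hA B hB => hl A (Finset.mem_insert_of_mem hA) B (Finset.mem_insert_of_mem hB))
      (fun A hA => hx A (Finset.mem_insert_of_mem hA))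
    obtain ⟨sf, sg⟩ := hS M (fun A hA => by
      rcases hl A (Finset.mem_insert_of_mem hA) M (Finset.mem_insert_self _ _) with h | h | h
      · exact Or.inl h
      · exact Or.inl (Finset.eq_of_subset_of_card_le h (hmax A hA)).ge
      · exact Or.inr h)
    have hxM := hx M (Finset.mem_insert_self _ _)
    obtain ⟨g1, f1, hp1, hQ1, hS1⟩ := plank_step g f hp M sf sg (g' M) (f' M) x0
      ((hQ x0).2 ⟨hs0, fun A hA => hx A (Finset.mem_insert_of_mem hA)⟩) hxM.1 hxM.2
    refine ⟨g1, f1, hp1, ?_, ?_⟩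
    · intro x
      rw [hQ1, hQ, Finset.forall_mem_insert]
      tauto
    · intro S h
      rw [Finset.forall_mem_insert] at h
      obtain ⟨a, b⟩ := hS S h.2
      exact hS1 S h.1 a b

/-- A nonempty polyhedron given by arbitrary lower and upper bounds on a laminar
family containing all singletons is a generalized polymatroid. -/
theorem laminar_polyhedron_isGPolymatroid {α : Type*} [DecidableEq α] [Fintype α]
    (F : Set (Finset α)) (hF : Laminar F) (hsing : ∀ t : α, {t} ∈ F)
    (g' f' : Finset α → ℝ)
    (hne : {x : α → ℝ | ∀ A ∈ F, g' A ≤ ∑ t ∈ A, x t ∧ ∑ t ∈ A, x t ≤ f' A}.Nonempty) :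
    ∃ g f : Finset α → ℝ, Paramodular g f ∧
      {x : α → ℝ | ∀ A ∈ F, g' A ≤ ∑ t ∈ A, x t ∧ ∑ t ∈ A, x t ≤ f' A}
        = gPolymatroid g f := by
  classical
  obtain ⟨x0, hx0⟩ := hne
  have key : ∀ A, A ∈ F.toFinite.toFinset ↔ A ∈ F := fun A => Set.Finite.mem_toFinset _
  obtain ⟨g, f, hp, hQ, -⟩ := laminar_aux g' f' x0
    (fun t => by simpa using hx0 {t} (hsing t)) F.toFinite.toFinset
    (fun A hA B hB => hF A ((key A).1 hA) B ((key B).1 hB))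
    (fun A hA => hx0 A ((key A).1 hA))
  refine ⟨g, f, hp, ?_⟩
  ext x
  rw [hQ]
  constructor
  · intro hx
    exact ⟨fun t => by simpa using hx {t} (hsing t), fun A hA => hx A ((key A).1 hA)⟩
  · rintro ⟨-, hx⟩ A hA
    exact hx A ((key A).2 hA)
end

section
/- Let (g, f) be a real-valued paramodular pair on a finite set T, let e be a new element not in T, set T̃ = T ∪ {e}, and define f* : 2^{T̃} → ℝ by f*(A) = f(A) if e ∉ A and f*(A) = −g(T ∖ (A ∖ {e})) if e ∈ A. Then f* is a submodular function on T̃ with f*(∅) = 0 and f*(T̃) = 0. -/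
/-- Extension of a paramodular pair `(g, f)` on `T` to a single submodular function on
`T̃ = T ∪ {e}`, the new element `e` being modeled by `none : Option α`:
`f* A = f A` if `e ∉ A`, and `f* A = -g (T \ (A \ {e}))` if `e ∈ A`. -/
def fStar {α : Type*} [DecidableEq α] [Fintype α] (g f : Finset α → ℝ) :
    Finset (Option α) → ℝ :=
  fun A =>
    if none ∈ A then -g (Finset.univ \ Finset.eraseNone A) else f (Finset.eraseNone A)

/-- For a paramodular pair `(g, f)`, the extension `f*` is a submodular function on
`T̃ = T ∪ {e}` with `f* ∅ = 0` and `f* T̃ = 0`. -/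
theorem fStar_submodular {α : Type*} [DecidableEq α] [Fintype α]
    (g f : Finset α → ℝ) (h : Paramodular g f) :
    Submodular (fStar g f) ∧ fStar g f ∅ = 0 ∧ fStar g f Finset.univ = 0 := by
  obtain ⟨hg, hf, hg0, hf0, hc⟩ := h
  refine ⟨?_, ?_, ?_⟩
  · intro A B
    have hI : Finset.eraseNone (A ∩ B) = Finset.eraseNone A ∩ Finset.eraseNone B := by
      ext x; simp
    have hU : Finset.eraseNone (A ∪ B) = Finset.eraseNone A ∪ Finset.eraseNone B := by
      ext x; simp
    unfold fStar
    rw [hI, hU]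
    generalize Finset.eraseNone A = a
    generalize Finset.eraseNone B = b
    by_cases hA : none ∈ A <;> by_cases hB : none ∈ B <;>
      simp only [Finset.mem_inter, Finset.mem_union, hA, hB, and_true, true_and, or_true, true_or,
        and_false, false_and, or_false, and_self, or_self, if_true, if_false]
    · have h1 := hg (Finset.univ \ a) (Finset.univ \ b)
      have e1 : (Finset.univ \ a) ∩ (Finset.univ \ b) = Finset.univ \ (a ∪ b) := by
        ext x; simp
      have e2 : (Finset.univ \ a) ∪ (Finset.univ \ b) = Finset.univ \ (a ∩ b) := by
        ext x; simp; tauto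
      simp only [e1, e2] at h1
      linarith
    · have h1 := hc b (Finset.univ \ a)
      have e1 : b \ (Finset.univ \ a) = a ∩ b := by
        ext x; simp; tauto
      have e2 : (Finset.univ \ a) \ b = Finset.univ \ (a ∪ b) := by
        ext x; simp
      rw [e1, e2] at h1
      linarith
    · have h1 := hc a (Finset.univ \ b)
      have e1 : a \ (Finset.univ \ b) = a ∩ b := by
        ext x; simp
      have e2 : (Finset.univ \ b) \ a = Finset.univ \ (a ∪ b) := by
        ext x; simp; tauto
      rw [e1, e2] at h1
      linarith
    · exact hf a b
  · simp [fStar, hf0]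
  · have e : Finset.univ \ Finset.eraseNone (Finset.univ : Finset (Option α)) = ∅ := by
      ext x; simp
    simp only [fStar, Finset.mem_univ, if_true, e, hg0, neg_zero]
end

section
/- Every generalized polymatroid with a real-valued border pair is the projection of a 0-base polyhedron: let (g, f) be a real-valued paramodular pair on a finite set T, let e ∉ T, T̃ = T ∪ {e}, and define f* : 2^{T̃} → ℝ by f*(A) = f(A) if e ∉ A and f*(A) = −g(T ∖ (A ∖ {e})) if e ∈ A. Then f* is submodular with f*(T̃) = 0, and Q(g, f) is exactly the image of the base polyhedron B(f*) under the coordinate projection ℝ^{T̃} → ℝ^T that forgets the coordinate indexed by e. -/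
/-- The base polyhedron of a submodular function `f` with `f ∅ = 0`. -/
def basePolyhedron {α : Type*} [DecidableEq α] [Fintype α] (f : Finset α → ℝ) :
    Set (α → ℝ) :=
  {x | ∑ t : α, x t = f Finset.univ ∧ ∀ A : Finset α, ∑ t ∈ A, x t ≤ f A}

theorem sum_option_aux {α : Type*} [DecidableEq α] (A : Finset (Option α))
    (x : Option α → ℝ) :
    ∑ t ∈ A, x t = (if none ∈ A then x none else 0)
      + ∑ t ∈ Finset.eraseNone A, x (some t) := by
  have h1 : ∑ t ∈ Finset.eraseNone A, x (some t) = ∑ t ∈ A.erase none, x t := by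
    rw [← Finset.map_some_eraseNone, Finset.sum_map]
    rfl
  rw [h1]
  split_ifs with hA
  · rw [Finset.add_sum_erase A x hA]
  · rw [Finset.erase_eq_of_notMem hA, zero_add]

/-- Every generalized polymatroid is the projection of a 0-base polyhedron: `f*` is
submodular with `f* T̃ = 0`, and `Q(g, f)` is the image of `B(f*)` under the coordinate
projection forgetting the coordinate of the new element `e`. -/
theorem gPolymatroid_eq_proj_basePolyhedron {α : Type*} [DecidableEq α] [Fintype α]
    (g f : Finset α → ℝ) (h : Paramodular g f) :
    Submodular (fStar g f) ∧ fStar g f Finset.univ = 0 ∧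
      gPolymatroid g f
        = (fun x : Option α → ℝ => fun t : α => x (some t)) ''
            basePolyhedron (fStar g f) := by
  obtain ⟨hg, hf, g0, f0, hc⟩ := h
  have huniv : fStar g f Finset.univ = 0 := by
    have : Finset.eraseNone (Finset.univ : Finset (Option α)) = Finset.univ := by
      ext t; simp
    simp [fStar, this, g0]
  refine ⟨?_, huniv, ?_⟩
  · intro A B
    have e1 : Finset.eraseNone (A ∩ B) = Finset.eraseNone A ∩ Finset.eraseNone B := by
      ext t; simp
    have e2 : Finset.eraseNone (A ∪ B) = Finset.eraseNone A ∪ Finset.eraseNone B := by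
      ext t; simp
    simp only [fStar, e1, e2, Finset.mem_inter, Finset.mem_union]
    generalize Finset.eraseNone A = a
    generalize Finset.eraseNone B = b
    have k : ∀ a b : Finset α, f b - g (Finset.univ \ a) ≥
        f (a ∩ b) - g (Finset.univ \ (a ∪ b)) := by
      intro a b
      have := hc b (Finset.univ \ a)
      have i1 : b \ (Finset.univ \ a) = a ∩ b := by ext t; simp; tauto
      have i2 : (Finset.univ \ a) \ b = Finset.univ \ (a ∪ b) := by ext t; simp
      rwa [i1, i2] at this
    by_cases hA : none ∈ A <;> by_cases hB : none ∈ B <;> simp only [hA, hB, and_self, or_self, and_true, and_false, or_true, or_false, true_or, true_and, false_and, false_or, if_true, if_false]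
    · have := hg (Finset.univ \ a) (Finset.univ \ b)
      have i1 : (Finset.univ \ a) ∩ (Finset.univ \ b) = Finset.univ \ (a ∪ b) := by
        ext t; simp
      have i2 : (Finset.univ \ a) ∪ (Finset.univ \ b) = Finset.univ \ (a ∩ b) := by
        ext t; simp; tauto
      rw [i1, i2] at this
      linarith
    · have := k a b
      linarith
    · have := k b a
      rw [Finset.inter_comm, Finset.union_comm] at this
      linarith
    · exact hf a b
  · ext y
    constructor
    · intro hy
      refine ⟨fun o => o.elim (-∑ t, y t) y, ⟨?_, ?_⟩, rfl⟩
      · rw [huniv, Fintype.sum_option]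
        simp
      · intro A
        rw [sum_option_aux]
        simp only [fStar, Option.elim]
        split_ifs with hA
        · have h1 := (hy (Finset.univ \ Finset.eraseNone A)).1
          have h2 := Finset.sum_sdiff (f := y) (Finset.subset_univ (Finset.eraseNone A))
          linarith
        · have h1 := (hy (Finset.eraseNone A)).2
          linarith
    · rintro ⟨x, ⟨hx0, hx⟩, rfl⟩ A
      rw [huniv, Fintype.sum_option] at hx0
      constructor
      · have h1 := hx (Finset.insertNone (Finset.univ \ A))
        rw [sum_option_aux] at h1
        have e : Finset.univ \ (Finset.univ \ A) = A := by ext t; simp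
        simp only [fStar, Finset.none_mem_insertNone, if_true, Finset.eraseNone_insertNone, e] at h1
        have h2 := Finset.sum_sdiff (f := fun t => x (some t)) (Finset.subset_univ A)
        linarith
      · have h1 := hx (A.map Function.Embedding.some)
        rw [sum_option_aux] at h1
        simpa [fStar] using h1
end

section
/- Membership in a generalized polymatroid is equivalent to membership of the lifted vector in the associated 0-base polyhedron: let (g, f) be a real-valued paramodular pair on a finite set T, let e ∉ T, T̃ = T ∪ {e}, and define f* : 2^{T̃} → ℝ by f*(A) = f(A) if e ∉ A and f*(A) = −g(T ∖ (A ∖ {e})) if e ∈ A. For x ∈ ℝ^T define x* ∈ ℝ^{T̃} by x*_t = x_t for t ∈ T and x*_e = −Σ_{t∈T} x_t. Then x ∈ Q(g, f) if and only if x* ∈ B(f*), equivalently if and only if x*(A) ≤ f*(A) for every A ⊆ T̃. -/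
/-- The lift `x*` of `x ∈ ℝ^T` to `ℝ^{T̃}`: `x*_t = x_t` for `t ∈ T` and
`x*_e = -∑_{t ∈ T} x_t`. -/
def liftVec {α : Type*} [Fintype α] (x : α → ℝ) : Option α → ℝ :=
  fun o => o.elim (-(∑ t : α, x t)) x

theorem sum_liftVec_aux {α : Type*} [DecidableEq α] [Fintype α] (x : α → ℝ)
    (A : Finset (Option α)) :
    ∑ t ∈ A, liftVec x t =
      if none ∈ A then -(∑ t ∈ Finset.univ \ Finset.eraseNone A, x t)
      else ∑ t ∈ Finset.eraseNone A, x t := by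
  have key : ∑ t ∈ Finset.eraseNone A, x t = ∑ t ∈ A.erase none, liftVec x t := by
    rw [← Finset.map_some_eraseNone, Finset.sum_map]
    rfl
  have h2 := Finset.sum_sdiff (f := x) (Finset.subset_univ (Finset.eraseNone A))
  split_ifs with hA
  · rw [← Finset.add_sum_erase A _ hA, ← key]
    have h3 : liftVec x none = -(∑ t : α, x t) := rfl
    rw [h3]
    linarith
  · rw [key, Finset.erase_eq_of_notMem hA]

/-- Membership in a generalized polymatroid is equivalent to membership of the lifted
vector in the associated 0-base polyhedron: `x ∈ Q(g, f)` iff `x* ∈ B(f*)`, equivalently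
iff `x*(A) ≤ f*(A)` for every `A ⊆ T̃`. -/
theorem mem_gPolymatroid_iff_lift_mem_basePolyhedron {α : Type*} [DecidableEq α]
    [Fintype α] (g f : Finset α → ℝ) (h : Paramodular g f) (x : α → ℝ) :
    (x ∈ gPolymatroid g f ↔ liftVec x ∈ basePolyhedron (fStar g f)) ∧
      (x ∈ gPolymatroid g f ↔
        ∀ A : Finset (Option α), ∑ t ∈ A, liftVec x t ≤ fStar g f A) := by
  have main : x ∈ gPolymatroid g f ↔
      ∀ A : Finset (Option α), ∑ t ∈ A, liftVec x t ≤ fStar g f A := by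
    constructor
    · intro hx A
      rw [sum_liftVec_aux]
      unfold fStar
      split_ifs with hA
      · exact neg_le_neg (hx _).1
      · exact (hx _).2
    · intro hx A
      constructor
      · have := hx (Finset.insertNone (Finset.univ \ A))
        rw [sum_liftVec_aux] at this
        simpa [fStar] using this
      · have := hx (A.map Function.Embedding.some)
        rw [sum_liftVec_aux] at this
        simpa [fStar] using this
  refine ⟨?_, main⟩
  rw [main]
  constructor
  · intro hx
    refine ⟨?_, hx⟩
    have hg : g ∅ = 0 := h.2.2.1
    have he : Finset.eraseNone (Finset.univ : Finset (Option α)) = Finset.univ := by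
      ext a; simp
    rw [sum_liftVec_aux]
    simp [fStar, he, hg]
  · exact fun hx => hx.2
end
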